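/- Let α be a normal element of F_{q^n} over F_q and β = g ∘ α for g ∈ F_q[x]. Then β is a normal element of F_{q^n} over F_q if and only if gcd(x^n − 1, g(x)) = 1. -/

import Mathlib

open Polynomial

variable {Fq Fqn : Type*}

/-- Frobenius action of a polynomial on a field element: `f ∘ α = Σ aᵢ α^(q^i)`. -/
noncomputable def circ [Field Fq] [Field Fqn] [Algebra Fq Fqn] (q : ℕ) (f : Fq[X]) (α : Fqn) : Fqn :=
  f.sum fun i a => algebraMap Fq Fqn a * α ^ q ^ i

/-- `α` is a normal element: its conjugates `α, α^q, …, α^(q^(n-1))` form an `Fq`-basis. -/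
def IsNormal (Fq : Type*) {Fqn : Type*} [Field Fq] [Field Fqn] [Algebra Fq Fqn]
    (q n : ℕ) (α : Fqn) : Prop :=
  LinearIndependent Fq (fun i : Fin n => α ^ q ^ (i : ℕ)) ∧
    Submodule.span Fq (Set.range fun i : Fin n => α ^ q ^ (i : ℕ)) = ⊤

/-- `A` is the annihilator of `α`: the monic polynomial of least degree with `A ∘ α = 0`. -/
def IsAnnihilator [Field Fq] [Field Fqn] [Algebra Fq Fqn] (q : ℕ) (α : Fqn) (A : Fq[X]) : Prop :=
  A.Monic ∧ circ q A α = 0 ∧ ∀ B : Fq[X], B.Monic → circ q B α = 0 → A.degree ≤ B.degree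

lemma aux_circ (q : ℕ) [Field Fq] [Fintype Fq] [Field Fqn] [Algebra Fq Fqn]
    (hcard : Fintype.card Fq = q) (f : Fq[X]) (γ : Fqn) :
    circ q f γ = aeval (FiniteField.frobeniusAlgHom Fq Fqn).toLinearMap f γ := by
  have hp : ∀ i : ℕ, ((FiniteField.frobeniusAlgHom Fq Fqn).toLinearMap ^ i) γ = γ ^ q ^ i := by
    intro i
    induction i with
    | zero => simp
    | succ i ih =>
      rw [pow_succ', Module.End.mul_apply, ih]
      simp [FiniteField.coe_frobeniusAlgHom, hcard, pow_succ, pow_mul]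
  rw [circ, aeval_eq_sum_range, Polynomial.sum_over_range _ (by simp)]
  simp [LinearMap.sum_apply, hp, Algebra.smul_def]

lemma aux_normal (q n : ℕ) [Field Fq] [Fintype Fq] [Field Fqn] [Algebra Fq Fqn]
    (hcard : Fintype.card Fq = q)
    (hn : 0 < n) (hrank : Module.finrank Fq Fqn = n) (γ : Fqn) :
    IsNormal Fq q n γ ↔ ∀ h : Fq[X],
      aeval (FiniteField.frobeniusAlgHom Fq Fqn).toLinearMap h γ = 0 → X ^ n - 1 ∣ h := by
  have hfin : FiniteDimensional Fq Fqn := Module.finite_of_finrank_pos (by omega)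
  have hmon : (X ^ n - 1 : Fq[X]).Monic := monic_X_pow_sub_C 1 hn.ne'
  have hdeg : (X ^ n - 1 : Fq[X]).degree = n := degree_X_pow_sub_C hn 1
  have hcirc : ∀ (c : Fin n → Fq), aeval (FiniteField.frobeniusAlgHom Fq Fqn).toLinearMap
      (∑ i : Fin n, monomial (i : ℕ) (c i)) γ = ∑ i, c i • γ ^ q ^ (i : ℕ) := by
    intro c
    rw [map_sum, LinearMap.sum_apply]
    refine Finset.sum_congr rfl fun i _ => ?_
    rw [← aux_circ q hcard, circ, sum_monomial_index _ _ (by simp), Algebra.smul_def]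
  constructor
  · rintro ⟨hli, -⟩ h hh
    have hone : aeval (FiniteField.frobeniusAlgHom Fq Fqn).toLinearMap (X ^ n - 1 : Fq[X]) γ = 0 := by
      have : Finite Fqn := Module.finite_of_finite Fq
      have := Fintype.ofFinite Fqn
      have hc : Fintype.card Fqn = q ^ n := by
        rw [Module.card_eq_pow_finrank (K := Fq), hcard, hrank]
      have h1 : γ ^ q ^ n = γ := by rw [← hc]; exact FiniteField.pow_card γ
      rw [map_sub, LinearMap.sub_apply, ← aux_circ q hcard, circ, X_pow_eq_monomial,
        sum_monomial_index _ _ (by simp), h1]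
      simp
    rw [← modByMonic_eq_zero_iff_dvd hmon]
    set r := h %ₘ (X ^ n - 1) with hr
    have hrd : r.degree < n := hdeg ▸ degree_modByMonic_lt h hmon
    have hr0 : aeval (FiniteField.frobeniusAlgHom Fq Fqn).toLinearMap r γ = 0 := by
      have e := modByMonic_add_div h (X ^ n - 1 : Fq[X])
      rw [← e, mul_comm, map_add, map_mul, LinearMap.add_apply, Module.End.mul_apply, hone,
        map_zero, add_zero] at hh
      exact hh
    have hs : r = ∑ i : Fin n, monomial (i : ℕ) (r.coeff i) := by
      rw [Fin.sum_univ_eq_sum_range (fun i => monomial i (r.coeff i))]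
      by_cases h0 : r = 0
      · simp [h0]
      · exact r.as_sum_range' n ((natDegree_lt_iff_degree_lt h0).2 hrd)
    rw [hs, hcirc] at hr0
    have := Fintype.linearIndependent_iff.1 hli _ hr0
    rw [hs]
    exact Finset.sum_eq_zero fun i _ => by rw [this i, map_zero]
  · intro H
    have hli : LinearIndependent Fq (fun i : Fin n => γ ^ q ^ (i : ℕ)) := by
      rw [Fintype.linearIndependent_iff]
      intro c hc i
      have hd := H _ ((hcirc c).trans hc)
      have hlt : (∑ i : Fin n, monomial (i : ℕ) (c i)).degree < n := by
        refine (degree_sum_le _ _).trans_lt ?_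
        refine (Finset.sup_lt_iff (WithBot.bot_lt_coe n)).2 ?_
        intro j _
        exact (degree_monomial_le _ _).trans_lt (WithBot.coe_lt_coe.2 j.2)
      have h0 := eq_zero_of_dvd_of_degree_lt hd (hdeg ▸ hlt)
      have := congrArg (fun p => coeff p (i : ℕ)) h0
      simpa [finsetSum_coeff, coeff_monomial, Fin.val_inj] using this
    exact ⟨hli, hli.span_eq_top_of_card_eq_finrank' (by simp [hrank])⟩

theorem stmt6 (q n : ℕ) [Field Fq] [Fintype Fq] [Field Fqn] [Algebra Fq Fqn]
    (hq : ∃ p k : ℕ, p.Prime ∧ 0 < k ∧ q = p ^ k) (hcard : Fintype.card Fq = q)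
    (hn : 0 < n) (hrank : Module.finrank Fq Fqn = n)
    (α : Fqn) (hα : IsNormal Fq q n α) (g : Fq[X]) :
    IsNormal Fq q n (circ q g α) ↔ IsCoprime ((X : Fq[X]) ^ n - 1) g := by
  have hker : ∀ h : Fq[X], X ^ n - 1 ∣ h →
      aeval (FiniteField.frobeniusAlgHom Fq Fqn).toLinearMap h α = 0 := by
    have : FiniteDimensional Fq Fqn := Module.finite_of_finrank_pos (by omega)
    have : Finite Fqn := Module.finite_of_finite Fq
    have := Fintype.ofFinite Fqn
    have hc : Fintype.card Fqn = q ^ n := by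
      rw [Module.card_eq_pow_finrank (K := Fq), hcard, hrank]
    have h1 : α ^ q ^ n = α := by rw [← hc]; exact FiniteField.pow_card α
    rintro _ ⟨k, rfl⟩
    rw [mul_comm, map_mul, Module.End.mul_apply, map_sub, LinearMap.sub_apply,
      ← aux_circ q hcard (X ^ n), circ, X_pow_eq_monomial,
      sum_monomial_index _ _ (by simp), h1]
    simp
  rw [aux_normal q n hcard hn hrank] at hα ⊢
  simp only [aux_circ q hcard, ← Module.End.mul_apply, ← map_mul]
  constructor
  · intro H
    refine IsRelPrime.isCoprime ?_
    rintro d ⟨e, he⟩ ⟨k, rfl⟩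
    have h1 := H e (hker _ (by rw [he]; exact ⟨k, by ring⟩))
    have hne : (X ^ n - 1 : Fq[X]) ≠ 0 := (monic_X_pow_sub_C 1 hn.ne').ne_zero
    rw [he] at h1 hne
    obtain ⟨m, hm⟩ := h1
    have hene : e ≠ 0 := right_ne_zero_of_mul hne
    refine IsUnit.of_mul_eq_one m ?_
    refine mul_right_cancel₀ hene ?_
    rw [one_mul]
    nth_rewrite 2 [hm]
    ring
  · intro hco h hh
    exact hco.dvd_of_dvd_mul_right (hα _ hh)
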